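/- Let (S_n) be a sequence of numerical semigroups with μ(S_n) → 0 as n → ∞. Then R(S_n) → ∞ as n → ∞. -/

import Mathlib

open Filter Topology Set

/-- A numerical set: a cofinite subset of ℕ containing 0, not all of ℕ. -/
def IsNumericalSet (T : Set ℕ) : Prop :=
  0 ∈ T ∧ Tᶜ.Finite ∧ Tᶜ.Nonempty

/-- A numerical semigroup: a numerical set closed under addition. -/
def IsNumericalSemigroup (S : Set ℕ) : Prop :=
  IsNumericalSet S ∧ ∀ a ∈ S, ∀ b ∈ S, a + b ∈ S

/-- Frobenius number: the largest element of the complement. -/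
noncomputable def frob (T : Set ℕ) : ℕ := sSup Tᶜ

/-- The associated semigroup `A(T) = {t | t + T ⊆ T}`. -/
def AT (T : Set ℕ) : Set ℕ := {t : ℕ | ∀ x ∈ T, t + x ∈ T}

/-- Multiplicity: the smallest positive element. -/
noncomputable def mult (S : Set ℕ) : ℕ := sInf {x | x ∈ S ∧ 0 < x}

/-- `R(S) = f(S) - m(S)` as an integer. -/
noncomputable def RVal (S : Set ℕ) : ℤ := (frob S : ℤ) - (mult S : ℤ)

/-- `P(S)`: the number of numerical sets whose associated semigroup is `S`. -/
noncomputable def PCount (S : Set ℕ) : ℕ :=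
  {T : Set ℕ | IsNumericalSet T ∧ AT T = S}.ncard

/-- The density `μ(S) = P(S) / 2^(f(S)-1)`. -/
noncomputable def density (S : Set ℕ) : ℝ :=
  (PCount S : ℝ) / 2 ^ (frob S - 1)

/-- The numerical semigroup `N(D,f) = {0} ∪ {f - l : l ∈ D} ∪ (f, ∞)`. -/
def NSet (D : Finset ℕ) (f : ℕ) : Set ℕ :=
  {0} ∪ (fun l => f - l) '' (D : Set ℕ) ∪ {x | f < x}

/-- `B(D,f)`: numerical sets `T` with `f(T) = f` and
`A(T) ∩ [f - Max D, f - 1] = {f - l : l ∈ D}`. -/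
def BSet (D : Finset ℕ) (f : ℕ) : Set (Set ℕ) :=
  {T | IsNumericalSet T ∧ frob T = f ∧
    AT T ∩ Set.Icc (f - D.sup id) (f - 1) = (fun l => f - l) '' (D : Set ℕ)}

/-- `A_D = |B(D, 2 Max D + 1)|`. -/
noncomputable def AConst (D : Finset ℕ) : ℕ :=
  (BSet D (2 * D.sup id + 1)).ncard

/-- `B_l(k,f) = {T ∈ B({k},f) : T ∩ [1,l] = ∅}`. -/
def BlSet (l k f : ℕ) : Set (Set ℕ) :=
  {T | T ∈ BSet {k} f ∧ T ∩ Set.Icc 1 l = ∅}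

/-- `C_{l,k}`. -/
noncomputable def CConst (l k : ℕ) : ℕ :=
  if l ≤ k then (BlSet l k (2 * k + 1)).ncard else (BlSet l k (l + k + 1)).ncard

/-- `G_l(f) = {T : A(T) = N_f, T ∩ [1,l] = ∅}`. -/
def GSet (l f : ℕ) : Set (Set ℕ) :=
  {T | IsNumericalSet T ∧ AT T = NSet ∅ f ∧ T ∩ Set.Icc 1 l = ∅}

section Counting

/-- Number of subsets of `V` containing `A` and compatible with the shift by `s` on `X`. -/
lemma card_shift_compatible_le (V A X : Finset ℕ) (s : ℕ) (hA : A ⊆ V) (hX : X ⊆ V)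
    (hY : X.image (· + s) ⊆ V) (hAX : Disjoint A X) (hAY : Disjoint A (X.image (· + s)))
    (hXY : Disjoint X (X.image (· + s))) :
    (V.powerset.filter (fun U => A ⊆ U ∧ ∀ x ∈ X, x ∈ U → x + s ∈ U)).card *
        (2 ^ A.card * 4 ^ X.card) ≤ 3 ^ X.card * 2 ^ V.card := by
  classical
  set Y := X.image (· + s) with hYdef
  set W := V \ (A ∪ X ∪ Y) with hW
  have hYcard : Y.card = X.card :=
    Finset.card_image_of_injective _ (add_left_injective s)
  have hWcard : W.card + (A.card + X.card + X.card) = V.card := by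
    have h1 : (A ∪ X ∪ Y).card = A.card + X.card + Y.card := by
      rw [Finset.card_union_of_disjoint (Finset.disjoint_union_left.2 ⟨hAY, hXY⟩),
        Finset.card_union_of_disjoint hAX]
    have h2 := Finset.card_sdiff_add_card_eq_card
      (Finset.union_subset (Finset.union_subset hA hX) hY)
    rw [h1, hYcard] at h2
    exact h2
  have hle : (V.powerset.filter (fun U => A ⊆ U ∧ ∀ x ∈ X, x ∈ U → x + s ∈ U)).card
      ≤ ((Finset.univ : Finset (X → Fin 3)) ×ˢ W.powerset).card := by
    refine Finset.card_le_card_of_injOn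
      (fun U => (fun x => if (x : ℕ) ∈ U then 2 else if (x : ℕ) + s ∈ U then 1 else 0, U ∩ W))
      ?_ ?_
    · intro U _
      simp
    · intro U hU U' hU' h
      simp only [Finset.coe_filter, Finset.mem_powerset, Set.mem_ofPred_eq] at hU hU'
      obtain ⟨hUV, hUA, hUX⟩ := hU
      obtain ⟨hUV', hUA', hUX'⟩ := hU'
      simp only [Prod.mk.injEq] at h
      obtain ⟨h1, h2⟩ := h
      have hx : ∀ x ∈ X, (x ∈ U ↔ x ∈ U') ∧ (x + s ∈ U ↔ x + s ∈ U') := by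
        intro x hx
        have h3 := congrFun h1 ⟨x, hx⟩
        have h4 := hUX x hx
        have h5 := hUX' x hx
        simp only at h3
        by_cases a : x ∈ U <;> by_cases b : x ∈ U' <;> by_cases c : x + s ∈ U <;>
          by_cases e : x + s ∈ U' <;> simp_all
      ext y
      by_cases hyV : y ∈ V
      · by_cases hyA : y ∈ A
        · exact iff_of_true (hUA hyA) (hUA' hyA)
        by_cases hyX : y ∈ X
        · exact (hx y hyX).1
        by_cases hyY : y ∈ Y
        · obtain ⟨x, hxX, rfl⟩ := Finset.mem_image.1 hyY
          exact (hx x hxX).2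
        have hyW : y ∈ W := by simp [hW, hyV, hyA, hyX, hyY]
        have h3 := Finset.ext_iff.1 h2 y
        simpa [hyW] using h3
      · exact iff_of_false (fun h => hyV (hUV h)) (fun h => hyV (hUV' h))
  have hc : ((Finset.univ : Finset (X → Fin 3)) ×ˢ W.powerset).card
      = 3 ^ X.card * 2 ^ W.card := by
    simp [Finset.card_product]
  rw [hc] at hle
  calc _ ≤ (3 ^ X.card * 2 ^ W.card) * (2 ^ A.card * 4 ^ X.card) := Nat.mul_le_mul_right _ hle
    _ = 3 ^ X.card * 2 ^ V.card := by
      rw [← hWcard, show (4 : ℕ) = 2 * 2 by norm_num, mul_pow]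
      ring

lemma sum_three_quarters_pow_le (n : ℕ) : ∑ k ∈ Finset.range n, ((3 : ℝ) / 4) ^ k ≤ 4 := by
  have h : ∑ k ∈ Finset.range n, ((3 : ℝ) / 4) ^ k = 4 * (1 - (3 / 4) ^ n) := by
    induction n with
    | zero => simp
    | succ n ih => rw [Finset.sum_range_succ, ih]; ring
  rw [h]
  have : (0 : ℝ) ≤ (3 / 4) ^ n := by positivity
  linarith

/-- Subsets `U` of `(L, f - L)` such that `s` translates `[M + 1, L] ∪ U` into `U` except possibly
beyond `f - L`. -/
def shiftClosedSubsets (M L f s : ℕ) : Finset (Finset ℕ) :=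
  (Finset.Ioo L (f - L)).powerset.filter (fun U =>
    (Finset.Icc (M + 1) L).image (· + s) ⊆ U ∧
      ∀ x ∈ Finset.Ioo L (f - s - L), x ∈ U → x + s ∈ U)

lemma card_shiftClosedSubsets_le {M L f k : ℕ} (hL : L = 2 * M + 3) (hf : 4 * L + 10 ≤ f)
    (hk : f ≤ 2 * (f - 2 * L - 1 - k) + M) :
    ((shiftClosedSubsets M L f (f - 2 * L - 1 - k)).card : ℝ)
      ≤ (3 / 4) ^ k * (2 ^ (f - 2 * L - 1) / 8) := by
  obtain ⟨s, hs⟩ : ∃ s, s = f - 2 * L - 1 - k := ⟨_, rfl⟩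
  rw [← hs] at hk ⊢
  have hfs : f - s = 2 * L + 1 + k := by omega
  have h := card_shift_compatible_le (Finset.Ioo L (f - L))
    ((Finset.Icc (M + 1) L).image (· + s)) (Finset.Ioo L (f - s - L)) s ?_ ?_ ?_ ?_ ?_ ?_
  · rw [Finset.card_image_of_injective _ (add_left_injective s), Nat.card_Icc, Nat.card_Ioo,
      Nat.card_Ioo, show f - s - L - L - 1 = k by omega,
      show L + 1 - (M + 1) = M + 3 by omega, show f - L - L - 1 = f - 2 * L - 1 by omega] at h
    change (shiftClosedSubsets M L f s).card * _ ≤ _ at h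
    have h' : ((shiftClosedSubsets M L f s).card : ℝ) * (2 ^ (M + 3) * 4 ^ k)
        ≤ 3 ^ k * 2 ^ (f - 2 * L - 1) := by exact_mod_cast h
    have h8 : (8 : ℝ) ≤ 2 ^ (M + 3) := by
      rw [pow_add]
      have : (1 : ℝ) ≤ 2 ^ M := one_le_pow₀ (by norm_num)
      linarith
    have h4 : (0 : ℝ) < 4 ^ k := by positivity
    rw [div_pow, div_mul_div_comm, le_div_iff₀ (by positivity)]
    refine le_trans ?_ h'
    rw [mul_comm ((4 : ℝ) ^ k) 8]
    gcongr
  all_goals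
    simp only [Finset.disjoint_left, Finset.subset_iff, Finset.mem_image, Finset.mem_Ioo,
      Finset.mem_Icc]
  · rintro _ ⟨x, hx, rfl⟩; omega
  · intro x hx; omega
  · rintro _ ⟨x, hx, rfl⟩; omega
  · rintro _ ⟨x, hx, rfl⟩; omega
  · rintro _ ⟨x, hx, rfl⟩ ⟨y, hy, hxy⟩; omega
  · rintro x hx ⟨y, hy, hxy⟩; omega

/-- Half of the subsets of `(L, f - L)` avoid all the sets `shiftClosedSubsets M L f s` with
`(f - M) / 2 ≤ s < f - 2 * L`. -/
lemma exists_half_avoiding {M L f : ℕ} (hL : L = 2 * M + 3) (hf : 4 * L + 10 ≤ f) :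
    ∃ G ⊆ (Finset.Ioo L (f - L)).powerset, (2 : ℝ) ^ (f - 2 * L - 1) / 2 ≤ G.card ∧
      ∀ U ∈ G, ∀ s, f ≤ 2 * s + M → s < f - 2 * L → U ∉ shiftClosedSubsets M L f s := by
  classical
  set P := (Finset.Ioo L (f - L)).powerset with hP
  set K := (Finset.range f).filter (fun k => f ≤ 2 * (f - 2 * L - 1 - k) + M) with hK
  set B := K.biUnion (fun k => shiftClosedSubsets M L f (f - 2 * L - 1 - k)) with hB
  refine ⟨P \ B, Finset.sdiff_subset, ?_, ?_⟩
  · have hPc : P.card = 2 ^ (f - 2 * L - 1) := by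
      rw [hP, Finset.card_powerset, Nat.card_Ioo]
      congr 1
      omega
    have hBc : (B.card : ℝ) ≤ 2 ^ (f - 2 * L - 1) / 2 := by
      calc (B.card : ℝ)
          ≤ ∑ k ∈ K, ((shiftClosedSubsets M L f (f - 2 * L - 1 - k)).card : ℝ) := by
            exact_mod_cast Finset.card_biUnion_le
        _ ≤ ∑ k ∈ K, ((3 : ℝ) / 4) ^ k * (2 ^ (f - 2 * L - 1) / 8) :=
            Finset.sum_le_sum fun k hk =>
              card_shiftClosedSubsets_le hL hf (Finset.mem_filter.1 hk).2
        _ ≤ ∑ k ∈ Finset.range f, ((3 : ℝ) / 4) ^ k * (2 ^ (f - 2 * L - 1) / 8) :=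
            Finset.sum_le_sum_of_subset_of_nonneg (Finset.filter_subset _ _)
              fun _ _ _ => by positivity
        _ = (∑ k ∈ Finset.range f, ((3 : ℝ) / 4) ^ k) * (2 ^ (f - 2 * L - 1) / 8) := by
            rw [Finset.sum_mul]
        _ ≤ 4 * (2 ^ (f - 2 * L - 1) / 8) := by
            gcongr
            exact sum_three_quarters_pow_le f
        _ = 2 ^ (f - 2 * L - 1) / 2 := by ring
    have h1 : (P.card : ℝ) ≤ (P \ B).card + B.card := by
      have := Finset.card_le_card_sdiff_add_card (s := P) (t := B)
      exact_mod_cast this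
    rw [hPc] at h1
    push_cast at h1
    linarith
  · intro U hU s hs hsf hUs
    refine (Finset.mem_sdiff.1 hU).2 (Finset.mem_biUnion.2 ⟨f - 2 * L - 1 - s, ?_, ?_⟩)
    · simp only [hK, Finset.mem_filter, Finset.mem_range]
      omega
    · rwa [show f - 2 * L - 1 - (f - 2 * L - 1 - s) = s by omega]

end Counting

section Semigroups

variable {S : Set ℕ}

lemma IsNumericalSemigroup.frob_notMem (hS : IsNumericalSemigroup S) : frob S ∉ S :=
  Nat.sSup_mem hS.1.2.2 hS.1.2.1.bddAbove

lemma IsNumericalSemigroup.mem_of_frob_lt (hS : IsNumericalSemigroup S) {x : ℕ}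
    (hx : frob S < x) : x ∈ S := by
  by_contra h
  exact absurd (le_csSup hS.1.2.1.bddAbove h) (not_le.2 hx)

lemma mult_le_of_mem {x : ℕ} (hx : x ∈ S) (h0 : 0 < x) : mult S ≤ x :=
  Nat.sInf_le ⟨hx, h0⟩

lemma AT_subset {T : Set ℕ} (h0 : 0 ∈ T) : AT T ⊆ T := fun t ht => by simpa using ht 0 h0

lemma add_mem_AT {T : Set ℕ} {a b : ℕ} (ha : a ∈ AT T) (hb : b ∈ AT T) : a + b ∈ AT T :=
  fun x hx => by simpa [add_assoc] using ha _ (hb x hx)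

lemma IsNumericalSemigroup.AT_eq (hS : IsNumericalSemigroup S) : AT S = S :=
  (AT_subset hS.1.1).antisymm fun a ha b hb => hS.2 a ha b hb

lemma IsNumericalSemigroup.finite_setOf_AT_eq (hS : IsNumericalSemigroup S) :
    {T : Set ℕ | IsNumericalSet T ∧ AT T = S}.Finite := by
  refine (hS.1.2.1.finite_subsets.image compl).subset ?_
  rintro T ⟨hT, hTS⟩
  refine ⟨Tᶜ, ?_, compl_compl T⟩
  have : S ⊆ T := hTS ▸ AT_subset hT.1
  exact Set.compl_subset_compl.2 this

lemma IsNumericalSemigroup.one_le_PCount (hS : IsNumericalSemigroup S) : 1 ≤ PCount S :=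
  (Set.ncard_pos hS.finite_setOf_AT_eq).2 ⟨S, hS.1, hS.AT_eq⟩

/-- The numerical set built from `S` by adding `[M + 1, L]` and `U`. -/
def fillIn (S : Set ℕ) (M L : ℕ) (U : Finset ℕ) : Set ℕ :=
  {x | x ∈ S ∨ (M + 1 ≤ x ∧ x ≤ L) ∨ x ∈ U}

lemma AT_fillIn (hS : IsNumericalSemigroup S) {M L : ℕ} (hL : L = 2 * M + 3)
    (hf : 4 * L + 10 ≤ frob S) (hm : frob S ≤ mult S + M) {U : Finset ℕ}
    (hU : U ⊆ Finset.Ioo L (frob S - L))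
    (hgood : ∀ s, frob S ≤ 2 * s + M → s < frob S - 2 * L →
      U ∉ shiftClosedSubsets M L (frob S) s) :
    IsNumericalSet (fillIn S M L U) ∧ AT (fillIn S M L U) = S := by
  obtain ⟨f, hfdef⟩ : ∃ f, f = frob S := ⟨_, rfl⟩
  have hfS : f ∉ S := hfdef ▸ hS.frob_notMem
  have hbig : ∀ x, f < x → x ∈ S := fun x hx => hS.mem_of_frob_lt (hfdef ▸ hx)
  have hsmall : ∀ x ∈ S, x = 0 ∨ f ≤ x + M := by
    intro x hx
    rcases Nat.eq_zero_or_pos x with h | h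
    · exact Or.inl h
    · have := mult_le_of_mem hx h
      omega
  rw [← hfdef] at hf hU hgood
  have hU' : ∀ x ∈ U, L < x ∧ x < f - L := fun x hx => Finset.mem_Ioo.1 (hU hx)
  set T := fillIn S M L U
  have hST : S ⊆ T := fun x hx => Or.inl hx
  have hTS : ∀ x ∈ T, f - L ≤ x → x ∈ S := by
    intro x hx hxf
    rcases hx with h | h | h
    · exact h
    · omega
    · have := hU' x h
      omega
  have hfT : f ∉ T := fun h => hfS (hTS f h (by omega))
  have h0T : 0 ∈ T := hST hS.1.1
  refine ⟨⟨h0T, hS.1.2.1.subset (Set.compl_subset_compl.2 hST), f, hfT⟩, ?_⟩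
  have hSA : S ⊆ AT T := by
    intro t ht x hx
    rcases hsmall t ht with rfl | h
    · simpa using hx
    · rcases hx with hx | hx | hx
      · exact hST (hS.2 t ht x hx)
      · exact hST (hbig _ (by omega))
      · have := hU' x hx
        exact hST (hbig _ (by omega))
  refine Set.Subset.antisymm ?_ hSA
  by_contra hne
  obtain ⟨t, htA, htS⟩ := Set.not_subset.1 hne
  have hfin : (AT T \ S).Finite := hS.1.2.1.subset fun x hx => hx.2
  obtain ⟨s, ⟨hsA, hsS⟩, hsmax⟩ := hfin.exists_maximal ⟨t, htA, htS⟩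
  have hsT : s ∈ T := AT_subset h0T hsA
  have hs0 : 0 < s := Nat.pos_of_ne_zero fun h => hsS (h ▸ hS.1.1)
  have hssS : s + s ∈ S := by
    by_contra h
    have := hsmax ⟨add_mem_AT hsA hsA, h⟩ (by simp)
    omega
  have h2s : f ≤ 2 * s + M := by
    rcases hsmall _ hssS with h | h <;> omega
  have hsL : s < f - L := by
    by_contra h
    exact hsS (hTS s hsT (by omega))
  have hstep : ∀ x, M + 1 ≤ x → x ≤ L → s + x ∈ T := fun x h1 h2 =>
    hsA x (Or.inr (Or.inl ⟨h1, h2⟩))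
  have hgap : ∀ y ∈ T, f - L ≤ y → f ≤ y + M := by
    intro y hy hyL
    rcases hsmall y (hTS y hy hyL) with h | h <;> omega
  have hs2L : s < f - 2 * L := by
    by_contra h
    by_cases hc : f ≤ s + (L + M + 1)
    · have := hgap _ (hstep (M + 1) le_rfl (by omega)) (by omega)
      omega
    · have := hgap _ (hstep L (by omega) le_rfl) (by omega)
      omega
  refine hgood s h2s hs2L ?_
  have hmid : ∀ y ∈ T, L < y → y < f - L → y ∈ U := by
    intro y hy h1 h2
    rcases hy with h | h | h
    · rcases hsmall y h with h | h <;> omega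
    · omega
    · exact h
  simp only [shiftClosedSubsets, Finset.mem_filter, Finset.mem_powerset]
  refine ⟨hU, ?_, ?_⟩
  · intro y hy
    obtain ⟨x, hx, rfl⟩ := Finset.mem_image.1 hy
    rw [Finset.mem_Icc] at hx
    have := hstep x hx.1 hx.2
    rw [add_comm] at this
    exact hmid _ this (by omega) (by omega)
  · intro x hx hxU
    rw [Finset.mem_Ioo] at hx
    have := hsA x (Or.inr (Or.inr hxU))
    rw [add_comm] at this
    exact hmid _ this (by omega) (by omega)

lemma fillIn_injOn {M L : ℕ} (hL : L = 2 * M + 3)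
    (hm : frob S ≤ mult S + M) :
    Set.InjOn (fillIn S M L) ((Finset.Ioo L (frob S - L)).powerset : Set (Finset ℕ)) := by
  have key : ∀ U ⊆ Finset.Ioo L (frob S - L), ∀ x,
      x ∈ U ↔ x ∈ fillIn S M L U ∧ x ∈ Finset.Ioo L (frob S - L) := by
    intro U hU x
    refine ⟨fun h => ⟨Or.inr (Or.inr h), hU h⟩, ?_⟩
    rintro ⟨h | h | h, hx⟩
    · rw [Finset.mem_Ioo] at hx
      have := mult_le_of_mem h (by omega)
      omega
    · rw [Finset.mem_Ioo] at hx
      omega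
    · exact h
  intro U hU U' hU' h
  rw [Finset.mem_coe, Finset.mem_powerset] at hU hU'
  ext x
  rw [key U hU, key U' hU', h]

lemma IsNumericalSemigroup.half_le_PCount (hS : IsNumericalSemigroup S) {M L : ℕ}
    (hL : L = 2 * M + 3) (hf : 4 * L + 10 ≤ frob S) (hm : frob S ≤ mult S + M) :
    (2 : ℝ) ^ (frob S - 2 * L - 1) / 2 ≤ PCount S := by
  obtain ⟨G, hG, hcard, hgood⟩ := exists_half_avoiding hL hf
  refine hcard.trans ?_
  have : (G : Set (Finset ℕ)).ncard ≤ PCount S :=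
    Set.ncard_le_ncard_of_injOn (fillIn S M L)
      (fun U hU => AT_fillIn hS hL hf hm (Finset.mem_powerset.1 (hG hU)) (hgood U hU))
      ((fillIn_injOn hL hm).mono (Finset.coe_subset.2 hG)) hS.finite_setOf_AT_eq
  rw [Set.ncard_coe_finset] at this
  exact_mod_cast this

/-- The density is bounded below in terms of a bound on `f(S) - m(S)`. -/
lemma IsNumericalSemigroup.density_ge (hS : IsNumericalSemigroup S) {M : ℕ}
    (hm : frob S ≤ mult S + M) : (1 : ℝ) / 2 ^ (8 * M + 22) ≤ density S := by
  rw [density, div_le_div_iff₀ (by positivity) (by positivity), one_mul]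
  rcases le_or_gt (8 * M + 22) (frob S) with hf | hf
  · have h := hS.half_le_PCount rfl (by omega) hm
    calc (2 : ℝ) ^ (frob S - 1)
        ≤ 2 ^ (frob S - 2 * (2 * M + 3) - 1 + (8 * M + 21)) :=
          pow_le_pow_right₀ (by norm_num) (by omega)
      _ = 2 ^ (frob S - 2 * (2 * M + 3) - 1) / 2 * 2 ^ (8 * M + 22) := by ring
      _ ≤ PCount S * 2 ^ (8 * M + 22) := by gcongr
  · have h : (1 : ℝ) ≤ PCount S := by exact_mod_cast hS.one_le_PCount
    calc (2 : ℝ) ^ (frob S - 1) ≤ 1 * 2 ^ (8 * M + 22) := by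
          rw [one_mul]
          exact pow_le_pow_right₀ (by norm_num) (by omega)
      _ ≤ PCount S * 2 ^ (8 * M + 22) := by gcongr

end Semigroups

theorem stmt19 (S : ℕ → Set ℕ) (hS : ∀ n, IsNumericalSemigroup (S n))
    (hμ : Tendsto (fun n => density (S n)) atTop (nhds 0)) :
    Tendsto (fun n => RVal (S n)) atTop atTop := by
  refine tendsto_atTop.2 fun b => ?_
  have hε : (0 : ℝ) < 1 / 2 ^ (8 * b.toNat + 22) := by positivity
  filter_upwards [hμ.eventually_lt_const hε] with n hn
  by_contra! h
  refine absurd ((hS n).density_ge (M := b.toNat) ?_) (not_le.2 hn)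
  unfold RVal at h
  omega
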